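/- arXiv:1508.01241 — 4 statements merged into one kernel-verified Lean document; each statement's English description precedes it below -/
import Mathlib

section
/- Let h : ℝ → ℝ be continuously differentiable and 2π-periodic, and suppose h(t_0) = 0 for some t_0 ∈ ℝ. Then (sup_{t ∈ ℝ} |h(t)|)⁴ ≤ 16 · (∫_0^{2π} h(t)² dt) · (∫_0^{2π} h'(t)² dt). -/
/-- Lemma 2, quantitative Sobolev embedding `H¹(𝕋) ↪ L^∞(𝕋)`:
for a `C¹` periodic function vanishing somewhere, `‖h‖_∞⁴ ≤ 16 ‖h‖₂² ‖h'‖₂²`. -/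
theorem sobolev_embedding_quantitative
    (h : ℝ → ℝ) (hreg : ContDiff ℝ 1 h)
    (hper : Function.Periodic h (2 * Real.pi))
    (t₀ : ℝ) (hzero : h t₀ = 0) :
    (⨆ t : ℝ, |h t|) ^ 4
      ≤ 16 * (∫ t in (0 : ℝ)..(2 * Real.pi), (h t) ^ 2)
           * (∫ t in (0 : ℝ)..(2 * Real.pi), (deriv h t) ^ 2) := by
  have hpi : (0 : ℝ) < 2 * Real.pi := Real.two_pi_pos
  have hc : Continuous h := hreg.continuous
  have hd : Continuous (deriv h) := hreg.continuous_deriv le_rfl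
  have hda : ∀ x, HasDerivAt h (deriv h x) x := fun x =>
    (hreg.differentiable one_ne_zero x).hasDerivAt
  have hdper : Function.Periodic (deriv h) (2 * Real.pi) := by
    intro x
    rw [← deriv_comp_add_const]
    congr 1
    funext y
    exact hper y
  have eA : ∫ t in t₀..(t₀ + 2 * Real.pi), (h t) ^ 2
      = ∫ t in (0 : ℝ)..(2 * Real.pi), (h t) ^ 2 := by
    have hp : Function.Periodic (fun t => (h t) ^ 2) (2 * Real.pi) := fun x => by
      simp only [hper x]
    simpa using hp.intervalIntegral_add_eq t₀ 0
  have eB : ∫ t in t₀..(t₀ + 2 * Real.pi), (deriv h t) ^ 2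
      = ∫ t in (0 : ℝ)..(2 * Real.pi), (deriv h t) ^ 2 := by
    have hp : Function.Periodic (fun t => (deriv h t) ^ 2) (2 * Real.pi) := fun x => by
      simp only [hdper x]
    simpa using hp.intervalIntegral_add_eq t₀ 0
  have hA : 0 ≤ ∫ t in (0 : ℝ)..(2 * Real.pi), (h t) ^ 2 :=
    intervalIntegral.integral_nonneg hpi.le fun _ _ => sq_nonneg _
  have hB : 0 ≤ ∫ t in (0 : ℝ)..(2 * Real.pi), (deriv h t) ^ 2 :=
    intervalIntegral.integral_nonneg hpi.le fun _ _ => sq_nonneg _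
  rw [← eA, ← eB] at *
  set A := ∫ t in t₀..(t₀ + 2 * Real.pi), (h t) ^ 2 with hAdef
  set B := ∫ t in t₀..(t₀ + 2 * Real.pi), (deriv h t) ^ 2 with hBdef
  have key : ∀ t, (h t) ^ 4 ≤ 16 * A * B := by
    intro t
    obtain ⟨s, hs, hst⟩ := hper.exists_mem_Ico hpi t t₀
    rw [hst]
    have quad : ∀ c : ℝ, 0 ≤ A * (c * c) + (-(h s) ^ 2) * c + B := by
      intro c
      have h1 : ∫ x in t₀..s, c * (2 * h x * deriv h x) = c * h s ^ 2 := by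
        rw [intervalIntegral.integral_const_mul,
          intervalIntegral.integral_eq_sub_of_hasDerivAt (f := fun x => h x ^ 2)]
        · simp [hzero]
        · intro x _
          have hx := (hda x).fun_pow 2
          have e : ((2 : ℕ) : ℝ) * h x ^ (2 - 1) * deriv h x = 2 * h x * deriv h x := by norm_num
          rw [e] at hx
          exact hx
        · exact Continuous.intervalIntegrable (by fun_prop) _ _
      have h2 : ∫ x in t₀..s, c * (2 * h x * deriv h x)
          ≤ ∫ x in t₀..s, (c ^ 2 * h x ^ 2 + deriv h x ^ 2) := by
        apply intervalIntegral.integral_mono_on hs.1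
        · exact Continuous.intervalIntegrable (by fun_prop) _ _
        · exact Continuous.intervalIntegrable (by fun_prop) _ _
        · intro x _
          nlinarith [sq_nonneg (c * h x - deriv h x)]
      have h3 : ∫ x in t₀..s, (c ^ 2 * h x ^ 2 + deriv h x ^ 2)
          ≤ ∫ x in t₀..(t₀ + 2 * Real.pi), (c ^ 2 * h x ^ 2 + deriv h x ^ 2) := by
        apply intervalIntegral.integral_mono_interval le_rfl hs.1 hs.2.le
        · exact Filter.Eventually.of_forall fun x => by simp only [Pi.zero_apply]; positivity
        · exact Continuous.intervalIntegrable (by fun_prop) _ _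
      have h4 : ∫ x in t₀..(t₀ + 2 * Real.pi), (c ^ 2 * h x ^ 2 + deriv h x ^ 2)
          = c ^ 2 * A + B := by
        rw [intervalIntegral.integral_add, intervalIntegral.integral_const_mul]
        · exact Continuous.intervalIntegrable (by fun_prop) _ _
        · exact Continuous.intervalIntegrable (by fun_prop) _ _
      nlinarith
    have := discrim_le_zero quad
    unfold discrim at this
    nlinarith [mul_nonneg hA hB]
  have hC : 0 ≤ 16 * A * B := by positivity
  have hsup : (⨆ t : ℝ, |h t|) ≤ √(√(16 * A * B)) := by
    apply Real.iSup_le _ (Real.sqrt_nonneg _)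
    intro t
    apply Real.le_sqrt_of_sq_le
    apply Real.le_sqrt_of_sq_le
    rw [sq_abs]
    nlinarith [key t]
  have h0 : 0 ≤ ⨆ t : ℝ, |h t| := Real.iSup_nonneg fun _ => abs_nonneg _
  calc (⨆ t : ℝ, |h t|) ^ 4 ≤ √(√(16 * A * B)) ^ 4 := by gcongr
    _ = (√(√(16 * A * B)) ^ 2) ^ 2 := by ring
    _ = 16 * A * B := by rw [Real.sq_sqrt (Real.sqrt_nonneg _), Real.sq_sqrt hC]
end

section
/- Let γ : ℝ → ℝ² be continuous and 2π-periodic with γ(0) ≠ (0,0). Then there exists a unit vector ν ∈ ℝ² (‖ν‖ = 1) such that |⟨γ(0), ν⟩| ≥ ‖γ(0)‖/√2 and ∫_0^{2π} ‖γ(t)‖² dt ≤ 6 ∫_0^{2π} ⟨γ(t), ν⟩² dt. -/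
open scoped RealInnerProductSpace

/-- Lemma 3, random projections: for a closed planar curve with
`γ(0) ≠ 0` there is a direction `ν` whose projection preserves the value at `0` up to
`1/√2` and the `L²`-norm up to a factor `6`. -/
theorem random_projection_lemma
    (γ : ℝ → EuclideanSpace ℝ (Fin 2))
    (hcont : Continuous γ)
    (hper : Function.Periodic γ (2 * Real.pi))
    (h0 : γ 0 ≠ 0) :
    ∃ ν : EuclideanSpace ℝ (Fin 2), ‖ν‖ = 1 ∧
      ‖γ 0‖ / Real.sqrt 2 ≤ |⟪γ 0, ν⟫| ∧
      (∫ t in (0 : ℝ)..(2 * Real.pi), ‖γ t‖ ^ 2)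
        ≤ 6 * ∫ t in (0 : ℝ)..(2 * Real.pi), ⟪γ t, ν⟫ ^ 2 := by
  have hr : 0 < ‖γ 0‖ := norm_pos_iff.mpr h0
  have hr2 : ‖γ 0‖ ^ 2 = γ 0 0 ^ 2 + γ 0 1 ^ 2 := by
    rw [EuclideanSpace.real_norm_sq_eq, Fin.sum_univ_two]
  set r := ‖γ 0‖ with hrdef
  set p := γ 0 0 with hp
  set q := γ 0 1 with hq
  have hs : (0 : ℝ) < Real.sqrt 2 := by positivity
  have hs2 : Real.sqrt 2 ^ 2 = 2 := Real.sq_sqrt (by norm_num)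
  set s := Real.sqrt 2 with hsdef
  have hin : ∀ (v : EuclideanSpace ℝ (Fin 2)) (a b : ℝ), ⟪v, !₂[a, b]⟫ = v 0 * a + v 1 * b := by
    intro v a b
    simp [PiLp.inner_apply, Fin.sum_univ_two]
    ring
  have key : ∀ a b : ℝ, a ^ 2 + b ^ 2 = 2 * r ^ 2 → p * a + q * b = r ^ 2 →
      ‖(!₂[a / (r * s), b / (r * s)] : EuclideanSpace ℝ (Fin 2))‖ = 1 ∧
      r / s ≤ |⟪γ 0, !₂[a / (r * s), b / (r * s)]⟫| := by
    intro a b hab hpq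
    constructor
    · have h : ‖(!₂[a / (r * s), b / (r * s)] : EuclideanSpace ℝ (Fin 2))‖ ^ 2 = 1 := by
        rw [EuclideanSpace.real_norm_sq_eq, Fin.sum_univ_two]
        have : (a / (r * s)) ^ 2 + (b / (r * s)) ^ 2 = 1 := by
          rw [div_pow, div_pow, ← add_div, mul_pow, hs2, hab, div_eq_one_iff_eq (by positivity)]
          ring
        simpa using this
      exact (pow_eq_one_iff_of_nonneg (norm_nonneg _) two_ne_zero).mp h
    · rw [hin]
      refine le_trans (le_of_eq ?_) (le_abs_self _)
      rw [← hp, ← hq]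
      field_simp
      linarith
  obtain ⟨n1, m1⟩ := key (p - q) (p + q) (by rw [hr2]; ring) (by rw [hr2]; ring)
  obtain ⟨n2, m2⟩ := key (p + q) (q - p) (by rw [hr2]; ring) (by rw [hr2]; ring)
  have hsum : (∫ t in (0 : ℝ)..(2 * Real.pi), ‖γ t‖ ^ 2) =
      (∫ t in (0 : ℝ)..(2 * Real.pi), ⟪γ t, !₂[(p - q) / (r * s), (p + q) / (r * s)]⟫ ^ 2) +
      ∫ t in (0 : ℝ)..(2 * Real.pi), ⟪γ t, !₂[(p + q) / (r * s), (q - p) / (r * s)]⟫ ^ 2 := by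
    rw [← intervalIntegral.integral_add]
    · congr 1
      ext t
      rw [hin, hin, EuclideanSpace.real_norm_sq_eq, Fin.sum_univ_two]
      have e : (γ t 0 ^ 2 + γ t 1 ^ 2) * (r ^ 2 * s ^ 2) =
        (γ t 0 * (p - q) + γ t 1 * (p + q)) ^ 2 + (γ t 0 * (p + q) + γ t 1 * (q - p)) ^ 2 := by
        rw [hr2, hs2]; ring
      field_simp
      linarith
    · exact Continuous.intervalIntegrable (by fun_prop) _ _
    · exact Continuous.intervalIntegrable (by fun_prop) _ _
  have hpi : (0 : ℝ) ≤ 2 * Real.pi := by positivity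
  have p1 : 0 ≤ ∫ t in (0 : ℝ)..(2 * Real.pi),
      ⟪γ t, !₂[(p - q) / (r * s), (p + q) / (r * s)]⟫ ^ 2 :=
    intervalIntegral.integral_nonneg hpi fun t _ => sq_nonneg _
  have p2 : 0 ≤ ∫ t in (0 : ℝ)..(2 * Real.pi),
      ⟪γ t, !₂[(p + q) / (r * s), (q - p) / (r * s)]⟫ ^ 2 :=
    intervalIntegral.integral_nonneg hpi fun t _ => sq_nonneg _
  rcases le_total (∫ t in (0 : ℝ)..(2 * Real.pi),
      ⟪γ t, !₂[(p - q) / (r * s), (p + q) / (r * s)]⟫ ^ 2) (∫ t in (0 : ℝ)..(2 * Real.pi),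
      ⟪γ t, !₂[(p + q) / (r * s), (q - p) / (r * s)]⟫ ^ 2) with h | h
  · exact ⟨_, n2, m2, by rw [hsum]; linarith⟩
  · exact ⟨_, n1, m1, by rw [hsum]; linarith⟩
end

section
/- For every vector ℓ ∈ ℝ² and every α ∈ ℝ, ∫_{α−π/4}^{α+π/4} ⟨(cos s, sin s), ℓ⟩² ds ≥ ‖ℓ‖² · (π − 2)/4. -/
open scoped RealInnerProductSpace

/-- the average squared projection of a fixed vector onto unit directions
ranging over any quarter-circle arc is at least `(π-2)/4` times its squared length. -/
theorem quarter_arc_projection_bound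
    (ℓ : EuclideanSpace ℝ (Fin 2)) (α : ℝ) :
    ‖ℓ‖ ^ 2 * ((Real.pi - 2) / 4)
      ≤ ∫ s in (α - Real.pi / 4)..(α + Real.pi / 4),
          ⟪(WithLp.equiv 2 (Fin 2 → ℝ)).symm ![Real.cos s, Real.sin s], ℓ⟫ ^ 2 := by
  have h1 : ∀ s : ℝ, ⟪(WithLp.equiv 2 (Fin 2 → ℝ)).symm ![Real.cos s, Real.sin s], ℓ⟫
      = ℓ 0 * Real.cos s + ℓ 1 * Real.sin s := by
    intro s
    simp [PiLp.inner_apply, Fin.sum_univ_two]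
  have h2 : ‖ℓ‖ ^ 2 = ℓ 0 ^ 2 + ℓ 1 ^ 2 := by
    simp [EuclideanSpace.norm_sq_eq, Fin.sum_univ_two]
  simp only [h1]
  rw [h2]
  generalize ℓ 0 = a
  generalize ℓ 1 = b
  have hd : ∀ s : ℝ, HasDerivAt (fun s : ℝ => (a ^ 2 + b ^ 2) / 2 * s
      + (a ^ 2 - b ^ 2) / 2 * (Real.sin s * Real.cos s) + a * b * (Real.sin s) ^ 2)
      ((a * Real.cos s + b * Real.sin s) ^ 2) s := by
    intro s
    have hs := Real.hasDerivAt_sin s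
    have hc := Real.hasDerivAt_cos s
    have := (((hasDerivAt_id s).const_mul ((a ^ 2 + b ^ 2) / 2)).add
      ((hs.mul hc).const_mul ((a ^ 2 - b ^ 2) / 2))).add ((hs.pow 2).const_mul (a * b))
    refine this.congr_deriv ?_
    have h := Real.sin_sq_add_cos_sq s
    push_cast
    linear_combination (-(a ^ 2 + b ^ 2) / 2) * h
  rw [intervalIntegral.integral_eq_sub_of_hasDerivAt (fun s _ => hd s)
    (Continuous.intervalIntegrable (by fun_prop) _ _)]
  simp only [Real.sin_add, Real.cos_add, Real.sin_sub, Real.cos_sub, Real.sin_pi_div_four,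
    Real.cos_pi_div_four]
  have h := Real.sin_sq_add_cos_sq α
  have h2 : (√2 : ℝ) ^ 2 = 2 := Real.sq_sqrt (by norm_num)
  generalize Real.sin α = S at *
  generalize Real.cos α = C at *
  generalize (√2 : ℝ) = r at *
  rw [← sub_nonneg]
  have key := sq_nonneg (a * C + b * S)
  refine key.trans_eq ?_
  linear_combination ((a ^ 2 + b ^ 2) / 2) * h
    - ((a ^ 2 - b ^ 2) / 4 * (C ^ 2 - S ^ 2) + a * b * S * C) * h2
end

section
/- Let γ : ℝ → ℝ² be continuously differentiable and 2π-periodic, and suppose that for every unit vector ν ∈ ℝ² there exists t ∈ ℝ with ⟨γ(t), ν⟩ = 0. Then (sup_{t ∈ ℝ} ‖γ(t)‖)⁴ ≤ 64 · (∫_0^{2π} ‖γ(t)‖² dt) · (∫_0^{2π} ‖γ'(t)‖² dt). -/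
open scoped RealInnerProductSpace

theorem aux_cs (f g : ℝ → ℝ) (hf : Continuous f) (hg : Continuous g) (a b : ℝ) (hab : a ≤ b) :
    (∫ t in a..b, f t * g t) ^ 2 ≤ (∫ t in a..b, f t ^ 2) * (∫ t in a..b, g t ^ 2) := by
  have key : ∀ x : ℝ, 0 ≤ (∫ t in a..b, f t ^ 2) * (x * x) + (2 * ∫ t in a..b, f t * g t) * x
      + ∫ t in a..b, g t ^ 2 := by
    intro x
    have h0 : 0 ≤ ∫ t in a..b, (x * f t + g t) ^ 2 :=
      intervalIntegral.integral_nonneg hab (fun t _ => sq_nonneg _)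
    have h1 : (∫ t in a..b, (x * f t + g t) ^ 2) =
        ∫ t in a..b, ((x * x) * f t ^ 2 + (2 * x) * (f t * g t) + g t ^ 2) := by
      congr 1; ext t; ring
    rw [h1, intervalIntegral.integral_add, intervalIntegral.integral_add,
      intervalIntegral.integral_const_mul, intervalIntegral.integral_const_mul] at h0
    · linarith
    all_goals exact Continuous.intervalIntegrable (by fun_prop) _ _
  have := discrim_le_zero key
  unfold discrim at this
  nlinarith

theorem aux_pt
    (γ : ℝ → EuclideanSpace ℝ (Fin 2))
    (hreg : ContDiff ℝ 1 γ)
    (hper : Function.Periodic γ (2 * Real.pi))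
    (hproj : ∀ ν : EuclideanSpace ℝ (Fin 2), ‖ν‖ = 1 → ∃ t : ℝ, ⟪γ t, ν⟫ = 0) (s : ℝ) :
    ‖γ s‖ ^ 4
      ≤ 64 * (∫ t in (0 : ℝ)..(2 * Real.pi), ‖γ t‖ ^ 2)
           * (∫ t in (0 : ℝ)..(2 * Real.pi), ‖deriv γ t‖ ^ 2) := by
  have hpi : 0 < 2 * Real.pi := by positivity
  have hc : Continuous γ := hreg.continuous
  have hd : Continuous (deriv γ) := hreg.continuous_deriv le_rfl
  have hA : 0 ≤ ∫ t in (0 : ℝ)..(2 * Real.pi), ‖γ t‖ ^ 2 :=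
    intervalIntegral.integral_nonneg hpi.le (fun t _ => sq_nonneg _)
  have hB : 0 ≤ ∫ t in (0 : ℝ)..(2 * Real.pi), ‖deriv γ t‖ ^ 2 :=
    intervalIntegral.integral_nonneg hpi.le (fun t _ => sq_nonneg _)
  have hAB := mul_nonneg hA hB
  by_cases hz : γ s = 0
  · rw [hz]; simp only [norm_zero]; nlinarith
  have hn : ‖γ s‖ ≠ 0 := norm_ne_zero_iff.mpr hz
  obtain ⟨ν, hνdef⟩ : ∃ ν, ν = ‖γ s‖⁻¹ • γ s := ⟨_, rfl⟩
  have hν : ‖ν‖ = 1 := by rw [hνdef, norm_smul, norm_inv, norm_norm, inv_mul_cancel₀ hn]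
  have hs : ⟪γ s, ν⟫ = ‖γ s‖ := by
    rw [hνdef, real_inner_smul_right, real_inner_self_eq_norm_sq]; field_simp
  obtain ⟨t0, ht0⟩ := hproj ν hν
  obtain ⟨t1, ht1, he⟩ := hper.exists_mem_Ico hpi t0 s
  rw [he] at ht0
  have hderiv : ∀ t, HasDerivAt (fun t => ⟪γ t, ν⟫ ^ 2) (2 * ⟪γ t, ν⟫ * ⟪deriv γ t, ν⟫) t := by
    intro t
    have h := ((hreg.differentiable one_ne_zero) t).hasDerivAt
    have h2 := (h.inner ℝ (hasDerivAt_const t ν)).pow 2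
    have e : 2 * ⟪γ t, ν⟫ * ⟪deriv γ t, ν⟫ = ((2 : ℕ) : ℝ) * ⟪γ t, ν⟫ ^ (2 - 1) * (⟪γ t, (0 : EuclideanSpace ℝ (Fin 2))⟫ + ⟪deriv γ t, ν⟫) := by simp
    rw [e]
    exact h2
  have hftc := intervalIntegral.integral_eq_sub_of_hasDerivAt (a := s) (b := t1)
    (fun t _ => hderiv t) (Continuous.intervalIntegrable (by fun_prop) _ _)
  rw [ht0, hs] at hftc
  have h1 : ‖γ s‖ ^ 2 ≤ ∫ t in s..t1, 2 * (‖γ t‖ * ‖deriv γ t‖) := by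
    have : ‖∫ t in s..t1, 2 * ⟪γ t, ν⟫ * ⟪deriv γ t, ν⟫‖ ≤
        ∫ t in s..t1, 2 * (‖γ t‖ * ‖deriv γ t‖) := by
      apply intervalIntegral.norm_integral_le_of_norm_le ht1.1
      · refine Filter.Eventually.of_forall fun t _ => ?_
        have e1 := abs_real_inner_le_norm (γ t) ν
        have e2 := abs_real_inner_le_norm (deriv γ t) ν
        rw [hν, mul_one] at e1 e2
        rw [Real.norm_eq_abs, abs_mul, abs_mul, abs_two, mul_assoc]
        gcongr
      · exact Continuous.intervalIntegrable (by fun_prop) _ _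
    rw [hftc] at this
    refine le_trans ?_ this
    rw [Real.norm_eq_abs]
    refine le_trans ?_ (neg_le_abs _)
    simp
  have h2 : (∫ t in s..t1, 2 * (‖γ t‖ * ‖deriv γ t‖)) ≤
      ∫ t in s..(s + 2 * Real.pi), 2 * (‖γ t‖ * ‖deriv γ t‖) := by
    apply intervalIntegral.integral_mono_interval le_rfl ht1.1 ht1.2.le
    · exact Filter.Eventually.of_forall fun t => by simp only [Pi.zero_apply]; positivity
    · exact Continuous.intervalIntegrable (by fun_prop) _ _
  have hdper : Function.Periodic (deriv γ) (2 * Real.pi) := by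
    intro t
    rw [← deriv_comp_add_const]
    congr 1
    exact funext hper
  have h3 : (∫ t in s..(s + 2 * Real.pi), 2 * (‖γ t‖ * ‖deriv γ t‖)) =
      2 * ∫ t in (0:ℝ)..(2 * Real.pi), (‖γ t‖ * ‖deriv γ t‖) := by
    have hp : Function.Periodic (fun t => 2 * (‖γ t‖ * ‖deriv γ t‖)) (2 * Real.pi) := by
      intro t; simp only [hper t, hdper t]
    rw [hp.intervalIntegral_add_eq s 0, zero_add, intervalIntegral.integral_const_mul]
  have h4 := aux_cs (fun t => ‖γ t‖) (fun t => ‖deriv γ t‖) (by fun_prop) (by fun_prop)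
    0 (2 * Real.pi) hpi.le
  have h5 := (h1.trans h2).trans h3.le
  have h6 := pow_le_pow_left₀ (sq_nonneg _) h5 2
  nlinarith



/-- a closed `C¹` planar curve each of whose projections vanishes somewhere
satisfies `‖γ‖_∞⁴ ≤ 64 ‖γ‖₂² ‖γ'‖₂²`. -/
theorem curve_sup_norm_bound
    (γ : ℝ → EuclideanSpace ℝ (Fin 2))
    (hreg : ContDiff ℝ 1 γ)
    (hper : Function.Periodic γ (2 * Real.pi))
    (hproj : ∀ ν : EuclideanSpace ℝ (Fin 2), ‖ν‖ = 1 → ∃ t : ℝ, ⟪γ t, ν⟫ = 0) :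
    (⨆ t : ℝ, ‖γ t‖) ^ 4
      ≤ 64 * (∫ t in (0 : ℝ)..(2 * Real.pi), ‖γ t‖ ^ 2)
           * (∫ t in (0 : ℝ)..(2 * Real.pi), ‖deriv γ t‖ ^ 2) := by

  have hpt := aux_pt γ hreg hper hproj
  generalize 64 * (∫ t in (0 : ℝ)..(2 * Real.pi), ‖γ t‖ ^ 2)
           * (∫ t in (0 : ℝ)..(2 * Real.pi), ‖deriv γ t‖ ^ 2) = C at hpt ⊢
  have hC : 0 ≤ C := le_trans (by positivity) (hpt 0)
  have hr : √(√C) ^ 4 = C := by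
    rw [show √(√C) ^ 4 = (√(√C) ^ 2) ^ 2 by ring, Real.sq_sqrt (Real.sqrt_nonneg _),
      Real.sq_sqrt hC]
  have h : (⨆ t : ℝ, ‖γ t‖) ≤ √(√C) := by
    apply ciSup_le
    intro t
    apply le_of_pow_le_pow_left₀ (n := 4) (by norm_num) (Real.sqrt_nonneg _)
    rw [hr]; exact hpt t
  calc _ ≤ √(√C) ^ 4 := pow_le_pow_left₀ (Real.iSup_nonneg fun t => norm_nonneg _) h 4
    _ = C := hr
end
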